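/- For a given demand profile h, if the supply profile a ∈ ℕ^T is exactly adequate for h, then every supply profile b ∈ ℕ^T with a ⪯ b is also exactly adequate for h. -/

import Mathlib

open Finset

/-- The nonincreasing rearrangement `a↓` of `a`. -/
def sortedDesc {T : ℕ} (a : Fin T → ℕ) : Fin T → ℕ := fun t => a (Tuple.sort a t.rev)

/-- The supply profile `p` is exactly adequate for the demand profile `h`. -/
def IsExactlyAdequate {T N : ℕ} (p : Fin T → ℕ) (h : Fin N → ℕ) : Prop :=
  ∃ A : Fin N → Fin T → Bool,
    (∀ i, (∑ t, if A i t then 1 else 0) = h i) ∧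
    (∀ t, (∑ i, if A i t then 1 else 0) = p t)

theorem antitone_sortedDesc {T : ℕ} (a : Fin T → ℕ) : Antitone (sortedDesc a) :=
  fun _ _ huv => Tuple.monotone_sort a (Fin.rev_le_rev.mpr huv)

theorem IsExactlyAdequate.comp_perm {T N : ℕ} {p : Fin T → ℕ} {h : Fin N → ℕ}
    (hp : IsExactlyAdequate p h) (σ : Equiv.Perm (Fin T)) : IsExactlyAdequate (p ∘ σ) h := by
  obtain ⟨A, hrow, hcol⟩ := hp
  refine ⟨fun i t => A i (σ t), fun i => ?_, fun t => hcol (σ t)⟩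
  rw [← hrow i]
  exact Equiv.sum_comp σ fun t => if A i t then 1 else 0

theorem isExactlyAdequate_sortedDesc_iff {T N : ℕ} {p : Fin T → ℕ} {h : Fin N → ℕ} :
    IsExactlyAdequate (sortedDesc p) h ↔ IsExactlyAdequate p h := by
  have hσ : sortedDesc p = p ∘ (Fin.revPerm.trans (Tuple.sort p)) := rfl
  refine ⟨fun hp => ?_, fun hp => hσ ▸ hp.comp_perm _⟩
  have := (hσ ▸ hp).comp_perm (Fin.revPerm.trans (Tuple.sort p)).symm
  rwa [Function.comp_assoc, Equiv.self_comp_symm, Function.comp_id] at this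

theorem sum_sortedDesc {T : ℕ} (a : Fin T → ℕ) : ∑ v, sortedDesc a v = ∑ v, a v :=
  Equiv.sum_comp (Fin.revPerm.trans (Tuple.sort a)) a

/-- One unit of supply can be moved from a slot to a strictly less supplied one. -/
theorem IsExactlyAdequate.exists_transfer {T N : ℕ} {a : Fin T → ℕ} {h : Fin N → ℕ}
    (ha : IsExactlyAdequate a h) {i j : Fin T} (hij : a j < a i) :
    ∃ a' : Fin T → ℕ, IsExactlyAdequate a' h ∧
      ∀ v, a' v + (if v = i then 1 else 0) = a v + (if v = j then 1 else 0) := by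
  obtain ⟨A, hrow, hcol⟩ := ha
  obtain ⟨r, -, hr⟩ : ∃ r ∈ (univ : Finset (Fin N)),
      (if A r j then 1 else 0) < (if A r i then 1 else 0) := by
    apply exists_lt_of_sum_lt
    rwa [hcol, hcol]
  have hri : A r i = true := by by_contra hn; simp [hn] at hr
  have hrj : A r j = false := by by_contra hn; simp [hn, hri] at hr
  let A' : Fin N → Fin T → Bool := fun x t => if x = r then A r (Equiv.swap i j t) else A x t
  refine ⟨fun t => ∑ x, if A' x t then 1 else 0, ⟨A', fun x => ?_, fun _ => rfl⟩, fun v => ?_⟩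
  · rw [← hrow x]
    by_cases hx : x = r
    · subst hx
      simp only [A', if_true]
      exact Equiv.sum_comp (Equiv.swap i j) fun t => if A x t then 1 else 0
    · simp [A', hx]
  · have hrest : ∑ x ∈ univ.erase r, (if A' x v then 1 else 0) =
        ∑ x ∈ univ.erase r, (if A x v then 1 else 0) :=
      sum_congr rfl fun x hx => by simp [A', ne_of_mem_erase hx]
    have hentry : (if A' r v then 1 else 0) + (if v = i then 1 else 0) =
        (if A r v then 1 else 0) + (if v = j then 1 else 0) := by
      have hne : i ≠ j := fun e => by simp [e] at hij
      by_cases hvi : v = i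
      · simp [A', hvi, hri, hrj, hne]
      by_cases hvj : v = j
      · simp [A', hvj, hri, hrj, hne.symm]
      simp [A', hvi, hvj, Equiv.swap_apply_of_ne_of_ne]
    rw [← hcol v]
    simp only [← add_sum_erase univ _ (mem_univ r), hrest]
    omega

/-- The target `b` is nonincreasing, but `a` need not be: this keeps the hypotheses stable under
transfers. -/
theorem IsExactlyAdequate.of_sum_Ici_le {T N : ℕ} {a b : Fin T → ℕ} {h : Fin N → ℕ}
    (ha : IsExactlyAdequate a h) (hb : Antitone b)
    (htail : ∀ u, ∑ v ∈ Ici u, a v ≤ ∑ v ∈ Ici u, b v) (htot : ∑ v, a v = ∑ v, b v) :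
    IsExactlyAdequate b h := by
  induction hn : ∑ v, (a v - b v) using Nat.strong_induction_on generalizing a with
  | _ n ih =>
  subst hn
  by_cases hle : ∀ v, a v ≤ b v
  · have hab : a = b := funext fun v =>
      (sum_eq_sum_iff_of_le fun v _ => hle v).mp htot v (mem_univ v)
    exact hab ▸ ha
  push Not at hle
  obtain ⟨i, hi, hmax⟩ : ∃ i, b i < a i ∧ ∀ k, i < k → a k ≤ b k := by
    have hne : (univ.filter fun v => b v < a v).Nonempty := hle.imp fun v hv => by simpa using hv
    refine ⟨_, (mem_filter.mp (max'_mem _ hne)).2, fun k hk => ?_⟩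
    by_contra! hlt
    exact hk.not_ge (le_max' _ k (by simpa using hlt))
  obtain ⟨j, hij, hj⟩ : ∃ j, i < j ∧ a j < b j := by
    by_contra! hge
    refine (htail i).not_gt (sum_lt_sum (fun k hk => ?_) ⟨i, by simp, hi⟩)
    rcases (mem_Ici.mp hk).eq_or_lt with rfl | hk
    exacts [hi.le, hge k hk]
  have hbij := hb hij.le
  obtain ⟨a', ha', hrel⟩ := ha.exists_transfer (show a j < a i by omega)
  have hsum (S : Finset (Fin T)) :
      ∑ v ∈ S, a' v + (if i ∈ S then 1 else 0) = ∑ v ∈ S, a v + (if j ∈ S then 1 else 0) := by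
    simpa [sum_add_distrib] using sum_congr (rfl : S = S) fun v _ => hrel v
  refine ih _ ?_ ha' (fun u => ?_) ?_ rfl
  · refine sum_lt_sum (fun v _ => ?_) ⟨i, mem_univ i, ?_⟩
    · have := hrel v
      split_ifs at this <;> subst_vars <;> omega
    · have := hrel i
      simp only [if_true, if_neg hij.ne] at this
      omega
  · have hu := hsum (Ici u)
    have hau := htail u
    by_cases hju : j ∈ Ici u
    · by_cases hiu : i ∈ Ici u
      · simp only [hiu, hju, if_true] at hu
        omega
      · have hlt : ∑ v ∈ Ici u, a v < ∑ v ∈ Ici u, b v :=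
          sum_lt_sum (fun k hk => hmax k (by simp at hiu hk; exact hiu.trans_le hk)) ⟨j, hju, hj⟩
        simp only [hiu, hju, if_true, if_false] at hu
        omega
    · simp only [hju, if_false] at hu
      omega
  · have := hsum univ
    simp only [mem_univ, if_true] at this
    omega

/-- If `a` is exactly adequate for a demand profile `h`, then any supply profile
`b` with `a ⪯ b` (every tail sum of `a↓` at most the corresponding tail sum of
`b↓`, equal totals) is also exactly adequate for `h`. -/
theorem exactly_adequate_of_majorizes {T N : ℕ} (h : Fin N → ℕ) (hh : ∀ i, h i ≤ T)
    (a b : Fin T → ℕ)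
    (hmaj : (∀ u : Fin T, ∑ v ∈ Ici u, sortedDesc a v ≤ ∑ v ∈ Ici u, sortedDesc b v) ∧
      ∑ v, a v = ∑ v, b v)
    (hadeq : IsExactlyAdequate a h) :
    IsExactlyAdequate b h := by
  rw [← isExactlyAdequate_sortedDesc_iff] at hadeq ⊢
  exact hadeq.of_sum_Ici_le (antitone_sortedDesc b) hmaj.1
    (by rw [sum_sortedDesc, sum_sortedDesc, hmaj.2])
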